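/- Let σ ≤ 1/9 and a = 18/e. Let S = (x₁,...,x_m) be i.i.d. draws from N(0, σ²), and let Z = (1/m)·Σᵢ exp(a xᵢ²) be the empirical mean of exp(a x²) over S. Then with probability at least 1 − 3/m (over S), Z < 2, and consequently the uniform distribution over S is sub-Gaussian with parameter 1/3. -/

import Mathlib

open MeasureTheory ProbabilityTheory Real
open scoped NNReal ENNReal

/-- A distribution `Q` over `ℝ` is sub-Gaussian with parameter `σ` if for `X ~ Q`,
`E[exp(u(X − E X))] ≤ exp(u²σ²/2)` for all `u ∈ ℝ`. -/
def IsSubGaussianDist (Q : Measure ℝ) (σ : ℝ) : Prop :=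
  ∀ u : ℝ, ∫ x, Real.exp (u * (x - ∫ x', x' ∂Q)) ∂Q ≤ Real.exp (u ^ 2 * σ ^ 2 / 2)

lemma aux_second (y : ℝ) : Real.exp y ≤ (2 + y ^ 2) * Real.exp (y ^ 2 / 4) := by
  have key : Real.exp (y - y ^ 2 / 4) ≤ 2 + y ^ 2 := by
    by_cases h : y ≤ 85 / 100
    · have h1 : y - y ^ 2 / 4 ≤ 0.6931471803 := by nlinarith
      have h2 : y - y ^ 2 / 4 ≤ Real.log 2 := h1.trans Real.log_two_gt_d9.le
      have h3 : Real.exp (y - y ^ 2 / 4) ≤ 2 := by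
        calc _ ≤ Real.exp (Real.log 2) := Real.exp_le_exp.2 h2
          _ = 2 := Real.exp_log (by norm_num)
      nlinarith [sq_nonneg y]
    · push Not at h
      have h1 : y - y ^ 2 / 4 ≤ 1 := by nlinarith [sq_nonneg (y - 2)]
      have h3 := Real.exp_le_exp.2 h1
      have := Real.exp_one_lt_d9
      nlinarith
  have : Real.exp y = Real.exp (y - y ^ 2 / 4) * Real.exp (y ^ 2 / 4) := by
    rw [← Real.exp_add]; ring_nf
  rw [this]
  gcongr

lemma aux_exp (y : ℝ) : Real.exp y - 1 - y ≤ 4 * (Real.exp (y ^ 2 / 4) - 1) := by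
  have hq : ∀ z : ℝ, HasDerivAt (fun y : ℝ => Real.exp (y ^ 2 / 4))
      (Real.exp (z ^ 2 / 4) * (z / 2)) z := by
    intro z
    have h := (((hasDerivAt_id z).pow 2).div_const 4).exp
    convert! h using 1
    simp; ring
  have hg : ∀ z : ℝ, HasDerivAt (fun y : ℝ => 2 * y * Real.exp (y ^ 2 / 4) - Real.exp y + 1)
      ((2 + z ^ 2) * Real.exp (z ^ 2 / 4) - Real.exp z) z := by
    intro z
    have h := ((((hasDerivAt_id z).const_mul 2).mul (hq z)).sub (Real.hasDerivAt_exp z)).add_const 1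
    convert! h using 1
    simp; ring
  have hf : ∀ z : ℝ, HasDerivAt (fun y : ℝ => 4 * (Real.exp (y ^ 2 / 4) - 1) - (Real.exp y - 1 - y))
      (2 * z * Real.exp (z ^ 2 / 4) - Real.exp z + 1) z := by
    intro z
    have h := (((hq z).sub_const 1).const_mul 4).sub
      (((Real.hasDerivAt_exp z).sub_const 1).sub (hasDerivAt_id z))
    convert! h using 1
    ring
  have hmono : Monotone (fun y : ℝ => 2 * y * Real.exp (y ^ 2 / 4) - Real.exp y + 1) := by
    apply monotone_of_deriv_nonneg (fun z => (hg z).differentiableAt)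
    intro z
    rw [(hg z).deriv]
    linarith [aux_second z]
  set f : ℝ → ℝ := fun y : ℝ => 4 * (Real.exp (y ^ 2 / 4) - 1) - (Real.exp y - 1 - y) with hfd
  have hcont : Continuous f := continuous_iff_continuousAt.2 fun z => (hf z).continuousAt
  have hdiff : Differentiable ℝ f := fun z => (hf z).differentiableAt
  have f0 : f 0 = 0 := by simp [hfd]
  have : 0 ≤ f y := by
    rcases le_total 0 y with h | h
    · have : MonotoneOn f (Set.Ici 0) := by
        apply monotoneOn_of_deriv_nonneg (convex_Ici 0) hcont.continuousOn hdiff.differentiableOn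
        intro z hz
        rw [interior_Ici] at hz
        rw [(hf z).deriv]
        have := hmono (le_of_lt (Set.mem_Ioi.1 hz))
        simpa using this
      rw [← f0]; exact this (by simp) h h
    · have : AntitoneOn f (Set.Iic 0) := by
        apply antitoneOn_of_deriv_nonpos (convex_Iic 0) hcont.continuousOn hdiff.differentiableOn
        intro z hz
        rw [interior_Iic] at hz
        rw [(hf z).deriv]
        have := hmono (le_of_lt (Set.mem_Iio.1 hz))
        simpa using this
      rw [← f0]; exact this h (by simp) h
  simp only [hfd] at this
  linarith

lemma aux_bern (s v : ℝ) (h0 : 0 ≤ s) (h1 : s ≤ 1) :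
    Real.exp (s * v) - 1 ≤ s * (Real.exp v - 1) := by
  have := convexOn_exp.2 (Set.mem_univ v) (Set.mem_univ 0) h0 (by linarith : 0 ≤ 1 - s) (by ring)
  simp at this
  linarith

/-- Deterministic part: a bound on the empirical mean of `exp (b x²)`, `b = 243/16`,
gives the sub-Gaussian bound. -/
lemma det_bound (m : ℕ) (hm : 0 < m) (x : Fin m → ℝ)
    (h : (1 / m : ℝ) * ∑ i, Real.exp ((243 / 16) * x i ^ 2) < 5 / 3) (u : ℝ) :
    (1 / m : ℝ) * ∑ i, Real.exp (u * (x i - (1 / m : ℝ) * ∑ j, x j))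
      ≤ Real.exp (u ^ 2 * (1 / 3) ^ 2 / 2) := by
  have hm' : (0 : ℝ) < m := by exact_mod_cast hm
  set μ := (1 / m : ℝ) * ∑ j, x j with hμ
  have avg_mono : ∀ f g : Fin m → ℝ, (∀ i, f i ≤ g i) →
      (1 / m : ℝ) * ∑ i, f i ≤ (1 / m : ℝ) * ∑ i, g i := by
    intro f g hfg
    have := Finset.sum_le_sum (fun i (_ : i ∈ Finset.univ) => hfg i)
    gcongr
  set W := (1 / m : ℝ) * ∑ i, Real.exp ((243 / 16) * x i ^ 2) with hW
  have havg1 : ∀ c : ℝ, (1 / m : ℝ) * ∑ _i : Fin m, c = c := by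
    intro c; simp; field_simp
  have hfac : (1 / m : ℝ) * ∑ i, Real.exp (u * (x i - μ))
      = Real.exp (-(u * μ)) * ((1 / m : ℝ) * ∑ i, Real.exp (u * x i)) := by
    rw [mul_left_comm, Finset.mul_sum (a := Real.exp (-(u * μ)))]
    congr 2; ext i
    rw [← Real.exp_add]; ring_nf
  rw [hfac]
  rcases le_total (u ^ 2) (243 / 4) with hu | hu
  · have h1 : (1 / m : ℝ) * ∑ i, Real.exp (u * x i)
        ≤ (1 / m : ℝ) * ∑ i, (1 + u * x i
            + (u ^ 2 / (243 / 16)) * (Real.exp ((243 / 16) * x i ^ 2) - 1)) := by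
      apply avg_mono
      intro i
      have a1 := aux_exp (u * x i)
      have a2 := aux_bern (u ^ 2 / (243 / 4)) ((243 / 16) * x i ^ 2) (by positivity)
        (by rw [div_le_one (by norm_num)]; exact hu)
      have e : u ^ 2 / (243 / 4) * ((243 / 16) * x i ^ 2) = (u * x i) ^ 2 / 4 := by ring
      rw [e] at a2
      have e2 : u ^ 2 / (243 / 16) = 4 * (u ^ 2 / (243 / 4)) := by ring
      rw [e2]
      linarith
    have h2 : (1 / m : ℝ) * ∑ i, (1 + u * x i
            + (u ^ 2 / (243 / 16)) * (Real.exp ((243 / 16) * x i ^ 2) - 1))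
        = 1 + u * μ + (u ^ 2 / (243 / 16)) * (W - 1) := by
      rw [hW, hμ, Finset.sum_add_distrib, Finset.sum_add_distrib, ← Finset.mul_sum,
        ← Finset.mul_sum, Finset.sum_sub_distrib]
      simp
      field_simp
    rw [h2] at h1
    have h3 : 1 + u * μ + (u ^ 2 / (243 / 16)) * (W - 1) ≤ 
        Real.exp (u * μ + u ^ 2 * (1 / 3) ^ 2 / 2) := by
      have := Real.add_one_le_exp (u * μ + u ^ 2 * (1 / 3) ^ 2 / 2)
      nlinarith [sq_nonneg u]
    calc _ ≤ Real.exp (-(u * μ)) * Real.exp (u * μ + u ^ 2 * (1 / 3) ^ 2 / 2) := by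
          gcongr; exact h1.trans h3
      _ = _ := by rw [← Real.exp_add]; ring_nf
  · have h1 : (1 / m : ℝ) * ∑ i, Real.exp (u * x i)
        ≤ (1 / m : ℝ) * ∑ i, Real.exp (u ^ 2 / (243 / 4)) * Real.exp ((243 / 16) * x i ^ 2) := by
      apply avg_mono
      intro i
      rw [← Real.exp_add]
      apply Real.exp_le_exp.2
      nlinarith [sq_nonneg (u - 243 / 8 * x i)]
    rw [← Finset.mul_sum, mul_left_comm, ← hW] at h1
    have h2 : W ≤ Real.exp (2 / 3) := by
      have := Real.add_one_le_exp (2 / 3 : ℝ)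
      linarith
    have h3 : μ ^ 2 ≤ 32 / 729 := by
      have c1 : (1 / m : ℝ) * ∑ i : Fin m, (2 * μ * x i - μ ^ 2 + 16 / 243)
          ≤ (1 / m : ℝ) * ∑ i, (16 / 243) * Real.exp ((243 / 16) * x i ^ 2) := by
        apply avg_mono
        intro i
        have := Real.add_one_le_exp ((243 / 16) * x i ^ 2)
        nlinarith [sq_nonneg (x i - μ)]
      rw [← Finset.mul_sum, mul_left_comm _ (16 / 243 : ℝ), ← hW] at c1
      have c2 : (1 / m : ℝ) * ∑ i : Fin m, (2 * μ * x i - μ ^ 2 + 16 / 243)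
          = 2 * μ * μ - μ ^ 2 + 16 / 243 := by
        rw [Finset.sum_add_distrib, Finset.sum_sub_distrib, ← Finset.mul_sum, mul_add, mul_sub,
          havg1, havg1, mul_left_comm, ← hμ]
      rw [c2] at c1
      linarith
    calc _ ≤ Real.exp (-(u * μ)) * (Real.exp (u ^ 2 / (243 / 4)) * Real.exp (2 / 3)) := by
          exact mul_le_mul_of_nonneg_left (h1.trans (by gcongr)) (Real.exp_pos _).le
      _ ≤ _ := by
          rw [← Real.exp_add, ← Real.exp_add]
          apply Real.exp_le_exp.2
          nlinarith [sq_nonneg (u / 9 + 9 * μ / 2)]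

lemma gauss_exp (v : ℝ≥0) (c : ℝ) (h : 2 * c * v < 1) :
    Integrable (fun x : ℝ => Real.exp (c * x ^ 2)) (gaussianReal 0 v) ∧
    ∫ x, Real.exp (c * x ^ 2) ∂(gaussianReal 0 v) = (√(1 - 2 * c * v))⁻¹ := by
  by_cases hv : v = 0
  · subst hv
    simp [gaussianReal_zero_var, integrable_dirac]
  have hv' : (0 : ℝ) < v := by positivity
  have hk : 0 < 1 / (2 * (v : ℝ)) - c := by
    have : 1 / (2 * (v : ℝ)) - c = (1 - 2 * c * v) / (2 * v) := by field_simp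
    rw [this]
    exact div_pos (by linarith) (by linarith)
  have e : ∀ x, gaussianPDFReal 0 v x • Real.exp (c * x ^ 2)
      = (√(2 * π * v))⁻¹ * Real.exp (-(1 / (2 * (v : ℝ)) - c) * x ^ 2) := by
    intro x
    rw [gaussianPDFReal, smul_eq_mul, mul_assoc, ← Real.exp_add]
    congr 2
    field_simp
    ring
  constructor
  · rw [gaussianReal_of_var_ne_zero _ hv, integrable_withDensity_iff_integrable_smul'
      (measurable_gaussianPDF _ _) (ae_of_all _ fun _ => gaussianPDF_lt_top)]
    simp only [toReal_gaussianPDF, e]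
    exact (integrable_exp_neg_mul_sq hk).const_mul _
  · rw [integral_gaussianReal_eq_integral_smul hv]
    simp only [e]
    rw [integral_const_mul, integral_gaussian, ← Real.sqrt_inv, ← Real.sqrt_inv,
      ← Real.sqrt_mul (by positivity)]
    congr 1
    have : 1 / (2 * (v : ℝ)) - c = (1 - 2 * c * v) / (2 * v) := by field_simp
    rw [this]
    have : 1 - 2 * c * v ≠ 0 := by linarith
    field_simp

lemma gauss_moments (σ : ℝ≥0) (hσ : (σ : ℝ) ≤ 1 / 9) :
    MemLp (fun x : ℝ => Real.exp ((243 / 16) * x ^ 2)) 2 (gaussianReal 0 (σ ^ 2)) ∧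
    ∫ x, Real.exp ((243 / 16) * x ^ 2) ∂(gaussianReal 0 (σ ^ 2)) ≤ 1.265 ∧
    Var[fun x : ℝ => Real.exp ((243 / 16) * x ^ 2); gaussianReal 0 (σ ^ 2)] ≤ 0.4 := by
  have hs : (σ : ℝ) ^ 2 ≤ 1 / 81 := by nlinarith [σ.coe_nonneg]
  have g1 := gauss_exp (σ ^ 2) (243 / 16) (by push_cast; linarith)
  have g2 := gauss_exp (σ ^ 2) (243 / 8) (by push_cast; linarith)
  have sq : ∀ x : ℝ, Real.exp ((243 / 16) * x ^ 2) ^ 2 = Real.exp ((243 / 8) * x ^ 2) := by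
    intro x; rw [← Real.exp_nat_mul]; congr 1; push_cast; ring
  have hL : MemLp (fun x : ℝ => Real.exp ((243 / 16) * x ^ 2)) 2 (gaussianReal 0 (σ ^ 2)) := by
    rw [memLp_two_iff_integrable_sq (by fun_prop)]
    simp only [sq]
    exact g2.1
  push_cast at g1 g2
  set s : ℝ := (σ : ℝ) ^ 2
  have hs0 : 0 ≤ s := by positivity
  refine ⟨hL, ?_, ?_⟩
  · rw [g1.2]
    rw [inv_le_comm₀ (Real.sqrt_pos.2 (by linarith)) (by norm_num)]
    apply Real.le_sqrt_of_sq_le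
    norm_num
    linarith
  · rw [variance_eq_sub hL]
    simp only [Pi.pow_apply, sq]
    rw [g1.2, g2.2, inv_pow, Real.sq_sqrt (by linarith)]
    set p := √(1 - 2 * (243 / 8) * s) with hp
    have hpp : p ^ 2 = 1 - 2 * (243 / 8) * s := Real.sq_sqrt (by linarith)
    have hp1 : 1 / 2 ≤ p := Real.le_sqrt_of_sq_le (by linarith)
    have hp2 : p ≤ 1 := by
      rw [hp, Real.sqrt_le_iff]; constructor <;> linarith
    have e : 1 - 2 * (243 / 16) * s = (1 + p ^ 2) / 2 := by rw [hpp]; ring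
    rw [e]
    have : p⁻¹ - ((1 + p ^ 2) / 2)⁻¹ = (1 - p) ^ 2 / (p * (1 + p ^ 2)) := by
      field_simp
      ring
    rw [this, div_le_iff₀ (by positivity)]
    nlinarith [mul_nonneg (sub_nonneg.2 hp1) (sub_nonneg.2 hp1)]

lemma prob_bound (σ : ℝ≥0) (hσ : (σ : ℝ) ≤ 1 / 9) (m : ℕ) (hm : 0 < m) :
    (Measure.pi fun _ : Fin m => gaussianReal 0 (σ ^ 2))
      {x : Fin m → ℝ | (1 / m : ℝ) * ∑ i, Real.exp ((243 / 16) * x i ^ 2) < 5 / 3}ᶜ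
      ≤ 3 / m := by
  obtain ⟨hL, hE, hV⟩ := gauss_moments σ hσ
  have hm' : (0 : ℝ) < m := by exact_mod_cast hm
  set P := Measure.pi fun _ : Fin m => gaussianReal 0 (σ ^ 2) with hP
  set Y : ℝ → ℝ := fun x => Real.exp ((243 / 16) * x ^ 2) with hY
  set S : (Fin m → ℝ) → ℝ := ∑ i, fun x => Y (x i) with hS
  have hSapp : ∀ x, S x = ∑ i, Real.exp ((243 / 16) * x i ^ 2) := by
    intro x; simp [hS, hY]
  have hSL : MemLp S 2 P := by
    apply memLp_finsetSum'
    intro i _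
    exact hL.comp_measurePreserving (measurePreserving_eval _ i)
  have hSV : Var[S; P] = m * Var[Y; gaussianReal 0 (σ ^ 2)] := by
    rw [hS, hP, variance_sum_pi (fun _ => hL)]
    simp
  have hSE : ∫ x, S x ∂P = m * ∫ x, Y x ∂(gaussianReal 0 (σ ^ 2)) := by
    have hi : Integrable Y (gaussianReal 0 (σ ^ 2)) := hL.integrable (by norm_num)
    simp only [hS, Finset.sum_apply]
    rw [integral_finsetSum _ (fun i _ => integrable_comp_eval hi)]
    have : ∀ i : Fin m, ∫ x, Y (x i) ∂P = ∫ x, Y x ∂(gaussianReal 0 (σ ^ 2)) := fun i =>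
      integral_comp_eval (μ := fun _ : Fin m => gaussianReal 0 (σ ^ 2)) hi.aestronglyMeasurable
    rw [Finset.sum_congr rfl (fun i _ => this i)]
    simp
  have ch := meas_ge_le_variance_div_sq hSL (c := m * 0.4) (by positivity)
  calc _ ≤ P {x | (m : ℝ) * 0.4 ≤ |S x - ∫ x, S x ∂P|} := by
        apply measure_mono
        intro x hx
        simp only [Set.mem_compl_iff, Set.mem_setOf_eq, not_lt] at hx ⊢
        rw [← hSapp, one_div, ← div_eq_inv_mul, le_div_iff₀ hm'] at hx
        refine le_trans ?_ (le_abs_self _)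
        rw [hSE]
        nlinarith
    _ ≤ _ := ch
    _ ≤ ENNReal.ofReal (3 / m) := by
        apply ENNReal.ofReal_le_ofReal
        rw [hSV, div_le_div_iff₀ (by positivity) hm']
        nlinarith [mul_pos hm' hm']
    _ = _ := by
        rw [ENNReal.ofReal_div_of_pos hm']
        simp

/-- For `σ ≤ 1/9` and `a = 18/e`, if `S = (x₁,...,x_m)` are i.i.d. draws from `N(0,σ²)`
and `Z = (1/m) Σᵢ exp(a xᵢ²)`, then with probability at least `1 − 3/m` over `S` we have
`Z < 2`, and consequently the uniform (empirical) distribution over `S` is sub-Gaussian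
with parameter `1/3`. -/
theorem empirical_gaussian_subGaussian (σ : ℝ≥0) (hσ : (σ : ℝ) ≤ 1 / 9)
    (m : ℕ) (hm : 0 < m) :
    (Measure.pi fun _ : Fin m => gaussianReal 0 (σ ^ 2))
        {x : Fin m → ℝ |
          (1 / m : ℝ) * ∑ i, Real.exp ((18 / Real.exp 1) * x i ^ 2) < 2 ∧
          IsSubGaussianDist ((m : ℝ≥0∞)⁻¹ • ∑ i : Fin m, Measure.dirac (x i)) (1 / 3)}
      ≥ 1 - 3 / m := by
  have hm' : (0 : ℝ) < m := by exact_mod_cast hm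
  set A := {x : Fin m → ℝ | (1 / m : ℝ) * ∑ i, Real.exp ((243 / 16) * x i ^ 2) < 5 / 3} with hA
  have hmeas : MeasurableSet A := by
    apply measurableSet_lt <;> fun_prop
  have hpA := prob_bound σ hσ m hm
  have h1 : (Measure.pi fun _ : Fin m => gaussianReal 0 (σ ^ 2)) A ≥ 1 - 3 / m := by
    rw [← hA, prob_compl_eq_one_sub hmeas] at hpA
    rw [ge_iff_le, tsub_le_iff_right]
    rw [tsub_le_iff_right] at hpA
    rwa [add_comm]
  refine le_trans h1 (measure_mono ?_)
  intro x hx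
  simp only [hA, Set.mem_setOf_eq] at hx ⊢
  constructor
  · refine lt_of_le_of_lt ?_ (hx.trans (by norm_num))
    have hab : 18 / Real.exp 1 ≤ 243 / 16 := by
      rw [div_le_iff₀ (Real.exp_pos 1)]
      have := Real.exp_one_gt_d9
      linarith
    refine mul_le_mul_of_nonneg_left (Finset.sum_le_sum fun i _ => ?_) (by positivity)
    exact Real.exp_le_exp.2 (mul_le_mul_of_nonneg_right hab (sq_nonneg _))
  · have hint : ∀ f : ℝ → ℝ, ∫ y, f y ∂((m : ℝ≥0∞)⁻¹ • ∑ i : Fin m, Measure.dirac (x i))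
        = (1 / m : ℝ) * ∑ i, f (x i) := by
      intro f
      rw [integral_smul_measure, integral_finset_sum_measure (fun i _ => integrable_dirac (by simp))]
      simp
    intro u
    rw [hint, hint]
    exact det_bound m hm x hx u
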